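/- (Theorem 2) Let α, β > 0, let e ∈ (0,1), and let θ* < e be real. For each natural number n ≥ 1 and each ȳ₀ ∈ [0, 1-e], define G(n, ȳ₀) = ∬_{{(θ₁,θ₀) ∈ (0,1)² : θ₁ - θ₀ ≤ θ*}} f_Beta(θ₁; α+n(ȳ₀+e), β+n(1-ȳ₀-e)) · f_Beta(θ₀; α+nȳ₀, β+n(1-ȳ₀)) dθ₁ dθ₀. Then there exists a natural number N such that for all n ≥ N, sup_{ȳ₀ ∈ [0,1-e]} G(n+1, ȳ₀) ≤ sup_{ȳ₀ ∈ [0,1-e]} G(n, ȳ₀); equivalently, the worst-case confidence inf_{ȳ₀ ∈ [0,1-e]} (1 - G(n, ȳ₀)) increases monotonically with n for all n ≥ N. -/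

import Mathlib

open Real MeasureTheory

/-- The Beta function `B(a,b) = ∫₀¹ t^(a-1) (1-t)^(b-1) dt`. -/
noncomputable def betaFn (a b : ℝ) : ℝ :=
  ∫ t in (0:ℝ)..1, t ^ (a - 1) * (1 - t) ^ (b - 1)

/-- The Beta density `f_Beta(t; a, b) = t^(a-1)(1-t)^(b-1) / B(a,b)`. -/
noncomputable def betaPDF (t a b : ℝ) : ℝ :=
  t ^ (a - 1) * (1 - t) ^ (b - 1) / betaFn a b

/-- The double integral `G(n, ȳ₀)` of the product of the posterior Beta densities
over `{θ₁ - θ₀ ≤ θ*}`. -/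
noncomputable def Gfun (α β e θs : ℝ) (n : ℕ) (y₀ : ℝ) : ℝ :=
  ∫ p in {p : ℝ × ℝ | p.1 ∈ Set.Ioo (0:ℝ) 1 ∧ p.2 ∈ Set.Ioo (0:ℝ) 1 ∧ p.1 - p.2 ≤ θs},
    betaPDF p.1 (α + (n : ℝ) * (y₀ + e)) (β + (n : ℝ) * (1 - y₀ - e)) *
      betaPDF p.2 (α + (n : ℝ) * y₀) (β + (n : ℝ) * (1 - y₀))

lemma aux_rat {p x : ℝ} (hp0 : 0 ≤ p) (hp1 : p ≤ 1) (hx0 : 0 < x) (hx1 : x < 1) :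
    x ^ p * (1 - x) ^ (1 - p) ≤ p ^ p * (1 - p) ^ (1 - p) * (1 - (x - p) ^ 2) := by
  rcases hp0.eq_or_lt with rfl | hp0
  · simp; nlinarith
  rcases hp1.eq_or_lt with rfl | hp1
  · simp; nlinarith
  have hq : 0 < 1 - p := by linarith
  have hy : 0 < 1 - x := by linarith
  set s := √(x / p) with hs
  set t := √((1 - x) / (1 - p)) with ht
  have hs0 : 0 ≤ s := Real.sqrt_nonneg _
  have ht0 : 0 ≤ t := Real.sqrt_nonneg _
  have hs2 : s * s = x / p := Real.mul_self_sqrt (by positivity)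
  have ht2 : t * t = (1 - x) / (1 - p) := Real.mul_self_sqrt (by positivity)
  have hxs : x = p * (s * s) := by rw [hs2]; field_simp
  have hyt : 1 - x = (1 - p) * (t * t) := by rw [ht2]; field_simp
  have hAG := Real.geom_mean_le_arith_mean2_weighted hp0.le hq.le hs0 ht0 (by ring)
  have hc : p * (s * s) + (1 - p) * (t * t) = 1 := by rw [← hxs, ← hyt]; ring
  have e1 : x ^ p = p ^ p * (s ^ p * s ^ p) := by
    conv_lhs => rw [hxs]
    rw [Real.mul_rpow hp0.le (by positivity), Real.mul_rpow hs0 hs0]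
  have e2 : (1 - x) ^ (1 - p) = (1 - p) ^ (1 - p) * (t ^ (1 - p) * t ^ (1 - p)) := by
    conv_lhs => rw [hyt]
    rw [Real.mul_rpow hq.le (by positivity), Real.mul_rpow ht0 ht0]
  have hsq : (s ^ p * t ^ (1 - p)) ^ 2 ≤ (p * s + (1 - p) * t) ^ 2 :=
    pow_le_pow_left₀ (by positivity) hAG 2
  have i1 : 1 - (p * s + (1 - p) * t) ^ 2 = p * (1 - p) * (s - t) ^ 2 := by
    linear_combination -hc
  have i2 : x - p = p * (1 - p) * (s - t) * (s + t) := by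
    rw [hxs]; linear_combination p * hc
  have i3 : p * (1 - p) * (s + t) ^ 2 ≤ 1 := by
    nlinarith [sq_nonneg (p * s - (1 - p) * t)]
  have i4 : (x - p) ^ 2 ≤ p * (1 - p) * (s - t) ^ 2 := by
    have : (x - p) ^ 2 = (p * (1 - p) * (s - t) ^ 2) * (p * (1 - p) * (s + t) ^ 2) := by
      rw [i2]; ring
    rw [this]
    exact mul_le_of_le_one_right (by positivity) i3
  rw [e1, e2]
  have : p ^ p * (s ^ p * s ^ p) * ((1 - p) ^ (1 - p) * (t ^ (1 - p) * t ^ (1 - p))) =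
      p ^ p * (1 - p) ^ (1 - p) * (s ^ p * t ^ (1 - p)) ^ 2 := by ring
  rw [this]
  exact mul_le_mul_of_nonneg_left (by linarith) (by positivity)

lemma aux_gam {a p : ℝ} (ha : 0 < a) (hp0 : 0 ≤ p) (hp1 : p ≤ 1) :
    Real.Gamma a * a * (a + p) ^ p ≤ Real.Gamma (a + p) * (a + p) := by
  rcases hp0.eq_or_lt with rfl | hp0
  · simp
  rcases hp1.eq_or_lt with rfl | hp1
  · rw [Real.Gamma_add_one ha.ne', Real.rpow_one, mul_comm a]
  have hap : 0 < a + p := by linarith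
  have h := Real.Gamma_mul_add_mul_le_rpow_Gamma_mul_rpow_Gamma (s := a + p) (t := a + p + 1)
    hap (by linarith) hp0 (sub_pos.2 hp1) (by ring)
  have hG := Real.Gamma_pos_of_pos hap
  rw [show p * (a + p) + (1 - p) * (a + p + 1) = a + 1 by ring, Real.Gamma_add_one ha.ne',
    Real.Gamma_add_one hap.ne', Real.mul_rpow hap.le hG.le] at h
  have e1 : Real.Gamma (a + p) ^ p * Real.Gamma (a + p) ^ (1 - p) = Real.Gamma (a + p) := by
    rw [← Real.rpow_add hG]; simp
  have e2 : (a + p) ^ p * (a + p) ^ (1 - p) = a + p := by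
    rw [← Real.rpow_add hap]; simp
  calc _ = a * Real.Gamma a * (a + p) ^ p := by ring
    _ ≤ _ := mul_le_mul_of_nonneg_right h (by positivity)
    _ = (Real.Gamma (a + p) ^ p * Real.Gamma (a + p) ^ (1 - p)) *
        ((a + p) ^ p * (a + p) ^ (1 - p)) := by ring
    _ = _ := by rw [e1, e2]

lemma aux_gam2 {α p n : ℝ} (hα : 0 < α) (hn : 0 < n) (hp0 : 0 ≤ p) (hp1 : p ≤ 1) :
    Real.Gamma (α + n * p) * (n / (n + 1) * ((n + 1) ^ p * p ^ p)) ≤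
      Real.Gamma (α + (n + 1) * p) := by
  have ha : 0 < α + n * p := by positivity
  have hap : 0 < α + n * p + p := by positivity
  have h := aux_gam ha hp0 hp1
  have hG := Real.Gamma_pos_of_pos ha
  rw [← Real.mul_rpow (by positivity) hp0,
    show α + (n + 1) * p = α + n * p + p by ring]
  refine le_trans ?_ ((div_le_iff₀ hap).2 h)
  rw [mul_assoc, mul_div_assoc]
  refine mul_le_mul_of_nonneg_left ?_ hG.le
  rw [mul_div_right_comm]
  refine mul_le_mul ?_ ?_ (by positivity) (by positivity)
  · rw [div_le_div_iff₀ (by positivity) hap]; nlinarith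
  · exact Real.rpow_le_rpow (by positivity) (by nlinarith) hp0

lemma aux_int {a b : ℝ} (ha : 0 < a) (hb : 0 < b) :
    IntervalIntegrable (fun t : ℝ => t ^ (a - 1) * (1 - t) ^ (b - 1)) volume 0 1 ∧
    betaFn a b = ProbabilityTheory.beta a b := by
  have hC := Complex.betaIntegral_convergent (u := a) (v := b) (by simpa) (by simpa)
  have key : ∀ x ∈ Set.Ioc (0:ℝ) 1, RCLike.re ((x:ℂ) ^ ((a:ℂ) - 1) * (1 - (x:ℂ)) ^ ((b:ℂ) - 1)) =
      x ^ (a - 1) * (1 - x) ^ (b - 1) := by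
    intro x hx
    norm_cast
    rw [← Complex.ofReal_cpow hx.1.le, ← Complex.ofReal_cpow (by linarith [hx.2]),
      RCLike.re_to_complex, Complex.re_mul_ofReal, Complex.ofReal_re]
  rw [intervalIntegrable_iff_integrableOn_Ioc_of_le (by simp)] at hC ⊢
  refine ⟨(IntegrableOn.congr_fun (f := fun x : ℝ => RCLike.re ((x:ℂ) ^ ((a:ℂ) - 1) * (1 - (x:ℂ)) ^ ((b:ℂ) - 1))) hC.re key measurableSet_Ioc), ?_⟩
  rw [ProbabilityTheory.beta_eq_betaIntegralReal a b ha hb, betaFn, Complex.betaIntegral,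
    intervalIntegral.integral_of_le (by norm_num), intervalIntegral.integral_of_le (by norm_num),
    ← RCLike.re_to_complex, ← integral_re hC]
  exact (setIntegral_congr_fun measurableSet_Ioc key).symm

lemma betaFn_pos {a b : ℝ} (ha : 0 < a) (hb : 0 < b) : 0 < betaFn a b := by
  rw [(aux_int ha hb).2]; exact ProbabilityTheory.beta_pos ha hb

lemma aux_beta {α β p n : ℝ} (hα : 0 < α) (hβ : 0 < β) (hn : 0 < n) (hp0 : 0 ≤ p) (hp1 : p ≤ 1) :
    betaFn (α + n * p) (β + n * (1 - p)) *
      (n ^ 2 / ((n + 1) * (α + β + n)) * (p ^ p * (1 - p) ^ (1 - p))) ≤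
    betaFn (α + (n + 1) * p) (β + (n + 1) * (1 - p)) := by
  have hq0 : 0 ≤ 1 - p := by linarith
  have h1 := aux_gam2 hα hn hp0 hp1
  have h2 := aux_gam2 hβ hn hq0 (by linarith)
  have ha : 0 < α + n * p := by positivity
  have hb : 0 < β + n * (1 - p) := by positivity
  have ha' : 0 < α + (n + 1) * p := by positivity
  have hb' : 0 < β + (n + 1) * (1 - p) := by positivity
  rw [(aux_int ha hb).2, (aux_int ha' hb').2, ProbabilityTheory.beta, ProbabilityTheory.beta,
    show α + n * p + (β + n * (1 - p)) = α + β + n by ring,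
    show α + (n + 1) * p + (β + (n + 1) * (1 - p)) = α + β + n + 1 by ring,
    Real.Gamma_add_one (by positivity)]
  have hG := Real.Gamma_pos_of_pos (show 0 < α + β + n by positivity)
  have hGa := Real.Gamma_pos_of_pos ha
  have hGb := Real.Gamma_pos_of_pos hb
  have hGa' := Real.Gamma_pos_of_pos ha'
  have h3 := mul_le_mul h1 h2 (by positivity) hGa'.le
  rw [le_div_iff₀ (by positivity)]
  refine le_trans (le_of_eq ?_) h3
  have e : (n + 1) ^ p * (n + 1) ^ (1 - p) = n + 1 := by
    rw [← Real.rpow_add (by positivity)]; simp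
  have e2 : (n / (n + 1) * ((n + 1) ^ p * p ^ p)) * (n / (n + 1) * ((n + 1) ^ (1 - p) * (1 - p) ^ (1 - p)))
      = n ^ 2 / (n + 1) * (p ^ p * (1 - p) ^ (1 - p)) := by
    rw [show (n / (n + 1) * ((n + 1) ^ p * p ^ p)) * (n / (n + 1) * ((n + 1) ^ (1 - p) * (1 - p) ^ (1 - p)))
      = (n / (n + 1)) ^ 2 * ((n + 1) ^ p * (n + 1) ^ (1 - p)) * (p ^ p * (1 - p) ^ (1 - p)) by ring, e]
    field_simp
  rw [mul_mul_mul_comm (Real.Gamma (α + n * p)) (n / (n + 1) * ((n + 1) ^ p * p ^ p)), e2]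
  field_simp

lemma betaPDF_nonneg' {x a b : ℝ} (ha : 0 < a) (hb : 0 < b) (hx0 : 0 < x) (hx1 : x < 1) :
    0 ≤ betaPDF x a b := by
  have := betaFn_pos ha hb
  have : 0 < 1 - x := by linarith
  unfold betaPDF; positivity

lemma aux_pdf {α β p n x : ℝ} (hα : 0 < α) (hβ : 0 < β) (hn : 0 < n) (hp0 : 0 ≤ p) (hp1 : p ≤ 1)
    (hx0 : 0 < x) (hx1 : x < 1) :
    n ^ 2 / ((n + 1) * (α + β + n)) *
      betaPDF x (α + (n + 1) * p) (β + (n + 1) * (1 - p)) ≤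
    (1 - (x - p) ^ 2) * betaPDF x (α + n * p) (β + n * (1 - p)) := by
  have hq0 : 0 ≤ 1 - p := by linarith
  have hy : 0 < 1 - x := by linarith
  have hB := betaFn_pos (show 0 < α + n * p by positivity) (show 0 < β + n * (1 - p) by positivity)
  have hB' := betaFn_pos (show 0 < α + (n + 1) * p by positivity)
    (show 0 < β + (n + 1) * (1 - p) by positivity)
  have h1 := aux_beta hα hβ hn hp0 hp1
  have h2 := aux_rat hp0 hp1 hx0 hx1
  unfold betaPDF
  set B := betaFn (α + n * p) (β + n * (1 - p))
  set B' := betaFn (α + (n + 1) * p) (β + (n + 1) * (1 - p))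
  set c := n ^ 2 / ((n + 1) * (α + β + n)) with hc
  have hc0 : 0 < c := by positivity
  have hk : 0 ≤ 1 - (x - p) ^ 2 := by nlinarith
  rw [show α + (n + 1) * p - 1 = (α + n * p - 1) + p by ring,
    show β + (n + 1) * (1 - p) - 1 = (β + n * (1 - p) - 1) + (1 - p) by ring,
    Real.rpow_add hx0, Real.rpow_add hy]
  set u := x ^ (α + n * p - 1)
  set v := (1 - x) ^ (β + n * (1 - p) - 1)
  have hu : 0 < u := Real.rpow_pos_of_pos hx0 _
  have hv : 0 < v := Real.rpow_pos_of_pos hy _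
  set m := p ^ p * (1 - p) ^ (1 - p)
  rw [← mul_div_assoc, ← mul_div_assoc, div_le_div_iff₀ hB' hB]
  calc c * (u * x ^ p * (v * (1 - x) ^ (1 - p))) * B
      = (c * u * v * B) * (x ^ p * (1 - x) ^ (1 - p)) := by ring
    _ ≤ (c * u * v * B) * (m * (1 - (x - p) ^ 2)) := mul_le_mul_of_nonneg_left h2 (by positivity)
    _ = (1 - (x - p) ^ 2) * (u * v) * (B * (c * m)) := by ring
    _ ≤ (1 - (x - p) ^ 2) * (u * v) * B' := mul_le_mul_of_nonneg_left h1 (by positivity)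

lemma pdf_int {a b : ℝ} (ha : 0 < a) (hb : 0 < b) :
    IntegrableOn (fun t => betaPDF t a b) (Set.Ioo 0 1) ∧
      ∫ t in Set.Ioo (0:ℝ) 1, betaPDF t a b = 1 := by
  have h := (aux_int ha hb).1
  rw [intervalIntegrable_iff_integrableOn_Ioo_of_le (by simp)] at h
  refine ⟨Integrable.div_const h _, ?_⟩
  unfold betaPDF
  rw [integral_div, ← integral_Ioc_eq_integral_Ioo, ← intervalIntegral.integral_of_le (by simp)]
  exact div_self (betaFn_pos ha hb).ne'

lemma prod_int {a b c d : ℝ} (ha : 0 < a) (hb : 0 < b) (hc : 0 < c) (hd : 0 < d) :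
    IntegrableOn (fun p : ℝ × ℝ => betaPDF p.1 a b * betaPDF p.2 c d)
      (Set.Ioo (0:ℝ) 1 ×ˢ Set.Ioo (0:ℝ) 1) ∧
    ∫ p in (Set.Ioo (0:ℝ) 1 ×ˢ Set.Ioo (0:ℝ) 1), betaPDF p.1 a b * betaPDF p.2 c d = 1 := by
  constructor
  · rw [IntegrableOn, Measure.volume_eq_prod, ← Measure.prod_restrict]
    exact Integrable.mul_prod (pdf_int ha hb).1 (pdf_int hc hd).1
  · rw [Measure.volume_eq_prod, setIntegral_prod_mul (fun t => betaPDF t a b)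
      (fun t => betaPDF t c d), (pdf_int ha hb).2, (pdf_int hc hd).2, mul_one]

lemma meas_reg (θs : ℝ) : MeasurableSet {p : ℝ × ℝ | p.1 ∈ Set.Ioo (0:ℝ) 1 ∧
    p.2 ∈ Set.Ioo (0:ℝ) 1 ∧ p.1 - p.2 ≤ θs} := by
  refine (measurable_fst measurableSet_Ioo).inter ((measurable_snd measurableSet_Ioo).inter ?_)
  exact measurableSet_le (f := fun p : ℝ × ℝ => p.1 - p.2) (g := fun _ => θs) (by fun_prop) (by fun_prop)

lemma reg_sub (θs : ℝ) : {p : ℝ × ℝ | p.1 ∈ Set.Ioo (0:ℝ) 1 ∧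
    p.2 ∈ Set.Ioo (0:ℝ) 1 ∧ p.1 - p.2 ≤ θs} ⊆ Set.Ioo (0:ℝ) 1 ×ˢ Set.Ioo (0:ℝ) 1 :=
  fun _ hp => ⟨hp.1, hp.2.1⟩

lemma Gfun_le_one {α β e θs y : ℝ} (n : ℕ) (hα : 0 < α) (hβ : 0 < β) (he0 : 0 < e)
    (hy0 : 0 ≤ y) (hy1 : y ≤ 1 - e) : Gfun α β e θs n y ≤ 1 := by
  have h1 : 0 ≤ 1 - y - e := by linarith
  have h2 : 0 ≤ 1 - y := by linarith
  have h0 : (0:ℝ) ≤ n := n.cast_nonneg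
  have ha : 0 < α + (n:ℝ) * (y + e) := by positivity
  have hb : 0 < β + (n:ℝ) * (1 - y - e) := by positivity
  have hc : 0 < α + (n:ℝ) * y := by positivity
  have hd : 0 < β + (n:ℝ) * (1 - y) := by positivity
  obtain ⟨hi, he⟩ := prod_int ha hb hc hd
  rw [← he]
  refine setIntegral_mono_set hi ?_ (reg_sub θs).eventuallyLE
  refine ae_restrict_of_forall_mem (measurableSet_Ioo.prod measurableSet_Ioo) fun p hp => ?_
  exact mul_nonneg (betaPDF_nonneg' ha hb hp.1.1 hp.1.2) (betaPDF_nonneg' hc hd hp.2.1 hp.2.2)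

lemma aux_ab {d a b : ℝ} (h : d ≤ a) (hb : 0 ≤ b) (ha : a ≤ 1) : (1 - a) * (1 - b) ≤ 1 - d := by
  nlinarith [mul_nonneg (sub_nonneg.2 ha) hb]

lemma Gfun_step {α β e θs y : ℝ} (n : ℕ) (hn : 1 ≤ n) (hα : 0 < α) (hβ : 0 < β) (he0 : 0 < e)
    (hθ : θs < e) (hy0 : 0 ≤ y) (hy1 : y ≤ 1 - e)
    (hbig : 1 - (e - θs) ^ 2 / 4 ≤ ((n:ℝ) ^ 2 / (((n:ℝ) + 1) * (α + β + n))) ^ 2) :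
    Gfun α β e θs (n + 1) y ≤ Gfun α β e θs n y := by
  have h1 : 0 ≤ 1 - (y + e) := by linarith
  have h2 : 0 ≤ 1 - y := by linarith
  have h0 : (0:ℝ) < n := by exact_mod_cast hn
  have ha : 0 < α + (n:ℝ) * (y + e) := by positivity
  have hb : 0 < β + (n:ℝ) * (1 - (y + e)) := by positivity
  have hc : 0 < α + (n:ℝ) * y := by positivity
  have hd : 0 < β + (n:ℝ) * (1 - y) := by positivity
  have ha' : 0 < α + ((n:ℝ) + 1) * (y + e) := by positivity
  have hb' : 0 < β + ((n:ℝ) + 1) * (1 - (y + e)) := by positivity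
  have hc' : 0 < α + ((n:ℝ) + 1) * y := by positivity
  have hd' : 0 < β + ((n:ℝ) + 1) * (1 - y) := by positivity
  unfold Gfun
  rw [sub_sub]
  push_cast
  refine setIntegral_mono_on ((prod_int ha' hb' hc' hd').1.mono_set (reg_sub θs))
    ((prod_int ha hb hc hd).1.mono_set (reg_sub θs)) (meas_reg θs) ?_
  rintro ⟨x, z⟩ ⟨⟨hx0, hx1⟩, ⟨hz0, hz1⟩, hxz⟩
  dsimp only at *
  have k1 := aux_pdf hα hβ h0 (by positivity) (sub_nonneg.1 h1) hx0 hx1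
  have k2 := aux_pdf hα hβ h0 hy0 (sub_nonneg.1 h2) hz0 hz1
  have n1 := betaPDF_nonneg' ha hb hx0 hx1
  have n2 := betaPDF_nonneg' hc hd hz0 hz1
  have n1' := betaPDF_nonneg' ha' hb' hx0 hx1
  have n2' := betaPDF_nonneg' hc' hd' hz0 hz1
  set c := (n:ℝ) ^ 2 / (((n:ℝ) + 1) * (α + β + n)) with hcdef
  have hc0 : 0 < c := by positivity
  have hu : (x - (y + e)) ^ 2 ≤ 1 := by
    rw [sq_le_one_iff_abs_le_one, abs_le]; constructor <;> linarith
  have hv : (z - y) ^ 2 ≤ 1 := by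
    rw [sq_le_one_iff_abs_le_one, abs_le]; constructor <;> linarith
  have k3 := mul_le_mul k1 k2 (by positivity) (mul_nonneg (by linarith) n1)
  have hfac : (1 - (x - (y + e)) ^ 2) * (1 - (z - y) ^ 2) ≤ c ^ 2 := by
    refine le_trans ?_ hbig
    have hd : e - θs ≤ ((y + e) - x) + (z - y) := by linarith
    rcases le_total ((e - θs) / 2) ((y + e) - x) with h | h
    · have : ((e - θs) / 2) ^ 2 ≤ ((y + e) - x) ^ 2 := pow_le_pow_left₀ (by linarith) h 2
      exact aux_ab (by nlinarith) (sq_nonneg _) hu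
    · have : ((e - θs) / 2) ^ 2 ≤ (z - y) ^ 2 := pow_le_pow_left₀ (by linarith) (by linarith) 2
      rw [mul_comm]
      exact aux_ab (by nlinarith) (sq_nonneg _) hv
  refine le_of_mul_le_mul_left ?_ (pow_pos hc0 2)
  refine le_trans (le_of_eq (by ring)) (k3.trans ?_)
  rw [mul_mul_mul_comm]
  exact mul_le_mul_of_nonneg_right hfac (mul_nonneg n1 n2)

lemma aux_lim (α β : ℝ) : Filter.Tendsto
    (fun n : ℕ => ((n:ℝ) ^ 2 / (((n:ℝ) + 1) * (α + β + n))) ^ 2) Filter.atTop (nhds 1) := by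
  have h1 := tendsto_natCast_div_add_atTop (1:ℝ)
  have h2 := tendsto_natCast_div_add_atTop (α + β)
  have := (h1.mul h2).pow 2
  simp only [mul_one, one_pow] at this
  refine this.congr fun n => ?_
  rw [div_mul_div_comm, ← sq, add_comm (n:ℝ) (α + β)]

/-- (Theorem 2) For `α, β > 0`, `e ∈ (0,1)` and `θ* < e`, there exists `N` such that
for all `n ≥ N`, `sup_{ȳ₀ ∈ [0,1-e]} G(n+1, ȳ₀) ≤ sup_{ȳ₀ ∈ [0,1-e]} G(n, ȳ₀)`. -/
theorem twoArm_binary_sup_eventually_nonincreasing (α β : ℝ) (hα : 0 < α) (hβ : 0 < β)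
    (e : ℝ) (he0 : 0 < e) (he1 : e < 1) (θs : ℝ) (hθ : θs < e) :
    ∃ N : ℕ, ∀ n : ℕ, N ≤ n → 1 ≤ n →
      (⨆ y₀ : Set.Icc (0:ℝ) (1 - e), Gfun α β e θs (n + 1) y₀) ≤
        ⨆ y₀ : Set.Icc (0:ℝ) (1 - e), Gfun α β e θs n y₀ := by
  have hlt : 1 - (e - θs) ^ 2 / 4 < 1 := by
    have : 0 < (e - θs) ^ 2 := pow_pos (sub_pos.2 hθ) 2
    linarith
  obtain ⟨N, hN⟩ := Filter.eventually_atTop.1 ((aux_lim α β).eventually (lt_mem_nhds hlt))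
  refine ⟨N, fun n hn h1 => ?_⟩
  refine ciSup_mono ⟨1, ?_⟩ fun y => ?_
  · rintro _ ⟨y, rfl⟩
    exact Gfun_le_one n hα hβ he0 y.2.1 y.2.2
  · exact Gfun_step n h1 hα hβ he0 hθ y.2.1 y.2.2 (hN n hn).le
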